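/- Let P^{(1)}_{Y|X} and P^{(2)}_{Y|X} be Markov kernels from ℝ^n to ℝ^m, let P_X be a probability measure on ℝ^n, and let λ ≠ 0. Assume that for all x ∈ ℝ^n: P^{(1)}_{Y|X=x} ≪ P^{(2)}_{Y|X=x}; K_{h,P^{(2)}_{Y|X=x},x}(−λ) is finite; h(x,·) is integrable with respect to P^{(1)}_{Y|X=x}, P^{(2)}_{Y|X=x}, and the (h,P^{(2)}_{Y|X=x},λ)-Gibbs probability measure; and D(P^{(1)}_{Y|X=x}‖P^{(2)}_{Y|X=x}) is finite. Assume moreover that x ↦ G_h(x, P^{(1)}_{Y|X=x}, P^{(2)}_{Y|X=x}) is integrable with respect to P_X. Then Ḡ_h(P^{(1)}_{Y|X}, P^{(2)}_{Y|X}, P_X) = (1/λ) ∫ ( D(P^{(1)}_{Y|X=x}‖P^{(h,P^{(2)}_{Y|X=x},λ)}_{Y|X=x}) − D(P^{(2)}_{Y|X=x}‖P^{(h,P^{(2)}_{Y|X=x},λ)}_{Y|X=x}) − D(P^{(1)}_{Y|X=x}‖P^{(2)}_{Y|X=x}) ) dP_X(x). -/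

import Mathlib

open MeasureTheory Real ProbabilityTheory

/-- Real-valued relative entropy (KL divergence) `D(μ‖ν) = ∫ log (dμ/dν) dμ`. -/
noncomputable def klDivR {α : Type*} [MeasurableSpace α] (μ ν : Measure α) : ℝ :=
  ∫ y, Real.log ((μ.rnDeriv ν y).toReal) ∂μ

/-- `cgfK h Q x t = K_{h,Q,x}(t) = log ∫ exp (t * h x y) dQ(y)`. -/
noncomputable def cgfK {n m : ℕ} (h : (Fin n → ℝ) → (Fin m → ℝ) → ℝ)
    (Q : Measure (Fin m → ℝ)) (x : Fin n → ℝ) (t : ℝ) : ℝ :=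
  Real.log (∫ y, Real.exp (t * h x y) ∂Q)

/-- The `(h,Q,λ)`-Gibbs probability measure `P^{(h,Q,λ)}_{Y|X=x}`, which has density
`exp (-λ * h(x,y) - K_{h,Q,x}(-λ))` with respect to `Q`. -/
noncomputable def gibbs {n m : ℕ} (h : (Fin n → ℝ) → (Fin m → ℝ) → ℝ)
    (Q : Measure (Fin m → ℝ)) (lam : ℝ) (x : Fin n → ℝ) : Measure (Fin m → ℝ) :=
  Q.withDensity fun y => ENNReal.ofReal (Real.exp (-lam * h x y - cgfK h Q x (-lam)))

/-- The Gibbs measure is the exponentially tilted measure `Q.tilted (-λ * h(x,·))`. -/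
lemma gibbs_eq_tilted {n m : ℕ} (h : (Fin n → ℝ) → (Fin m → ℝ) → ℝ)
    (Q : Measure (Fin m → ℝ)) (lam : ℝ) (x : Fin n → ℝ)
    (hpos : 0 < ∫ y, Real.exp (-lam * h x y) ∂Q) :
    gibbs h Q lam x = Q.tilted fun y => -lam * h x y := by
  simp only [gibbs, cgfK, Measure.tilted, Real.exp_sub, Real.exp_log hpos]

/-- Relative entropy of `P` with respect to the Gibbs measure built on `Q`. -/
lemma klDivR_gibbs {n m : ℕ} (h : (Fin n → ℝ) → (Fin m → ℝ) → ℝ)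
    (P Q : Measure (Fin m → ℝ)) [IsProbabilityMeasure P] [SigmaFinite Q]
    (lam : ℝ) (x : Fin n → ℝ) (hPQ : P ≪ Q)
    (hexp : Integrable (fun y => Real.exp (-lam * h x y)) Q)
    (hpos : 0 < ∫ y, Real.exp (-lam * h x y) ∂Q)
    (hP : Integrable (h x) P) (hllr : Integrable (llr P Q) P) :
    klDivR P (gibbs h Q lam x)
      = klDivR P Q + lam * (∫ y, h x y ∂P) + cgfK h Q x (-lam) := by
  rw [gibbs_eq_tilted h Q lam x hpos]
  have key := integral_llr_tilted_right hPQ (hP.const_mul (-lam)) hexp hllr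
  rw [integral_const_mul] at key
  simp only [llr_def] at key
  rw [klDivR, key, klDivR, cgfK]
  ring

lemma klDivR_self {α : Type*} [MeasurableSpace α] (μ : Measure α) [SigmaFinite μ] :
    klDivR μ μ = 0 :=
  integral_eq_zero_of_ae (llr_self μ)

theorem stmt11 {n m : ℕ} (h : (Fin n → ℝ) → (Fin m → ℝ) → ℝ)
    (hMeas : Measurable (Function.uncurry h))
    (κ₁ κ₂ : Kernel (Fin n → ℝ) (Fin m → ℝ)) [IsMarkovKernel κ₁] [IsMarkovKernel κ₂]
    (PX : Measure (Fin n → ℝ)) [IsProbabilityMeasure PX]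
    (lam : ℝ) (hlam : lam ≠ 0)
    (hac : ∀ x, κ₁ x ≪ κ₂ x)
    (hKint : ∀ x, Integrable (fun y => Real.exp (-lam * h x y)) (κ₂ x))
    (hKpos : ∀ x, 0 < ∫ y, Real.exp (-lam * h x y) ∂(κ₂ x))
    (hInt1 : ∀ x, Integrable (h x) (κ₁ x)) (hInt2 : ∀ x, Integrable (h x) (κ₂ x))
    (hGint : ∀ x, Integrable (h x) (gibbs h (κ₂ x) lam x))
    (hKL : ∀ x, Integrable (fun y => Real.log (((κ₁ x).rnDeriv (κ₂ x) y).toReal)) (κ₁ x))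
    (hOuter : Integrable (fun x => (∫ y, h x y ∂(κ₁ x)) - ∫ y, h x y ∂(κ₂ x)) PX) :
    ∫ x, ((∫ y, h x y ∂(κ₁ x)) - ∫ y, h x y ∂(κ₂ x)) ∂PX
      = (1 / lam) * ∫ x, (klDivR (κ₁ x) (gibbs h (κ₂ x) lam x)
          - klDivR (κ₂ x) (gibbs h (κ₂ x) lam x)
          - klDivR (κ₁ x) (κ₂ x)) ∂PX := by
  rw [← integral_const_mul]
  refine integral_congr_ae (ae_of_all _ fun x => ?_)
  have hllr : Integrable (llr (κ₂ x) (κ₂ x)) (κ₂ x) :=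
    (integrable_zero _ ℝ _).congr (llr_self (κ₂ x)).symm
  dsimp only
  rw [klDivR_gibbs h (κ₁ x) (κ₂ x) lam x (hac x) (hKint x) (hKpos x) (hInt1 x) (hKL x),
    klDivR_gibbs h (κ₂ x) (κ₂ x) lam x .rfl (hKint x) (hKpos x) (hInt2 x) hllr, klDivR_self]
  field_simp
  ring
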